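/- arXiv:math-ph/0405022 — 2 statements merged into one kernel-verified Lean document; each statement's English description precedes it below -/
import Mathlib

section
/- Let B be an associative complex algebra, T : B → ℂ a linear functional satisfying T(AB) = T(BA) for all A, B ∈ B, and let ∇₁, …, ∇ₙ : B → B be ℂ-linear derivations (∇ⱼ(AB) = ∇ⱼ(A)·B + A·∇ⱼ(B)) which pairwise commute and satisfy T(∇ⱼ(A)) = 0 for all A ∈ B and all j. Define η(A₀, …, Aₙ) = Σ_{σ ∈ Sₙ} sgn(σ) · T(A₀ · ∇_{σ(1)}(A₁) · ⋯ · ∇_{σ(n)}(Aₙ)). Then the Hochschild coboundary of η vanishes: for all A₀, …, A_{n+1} ∈ B, Σ_{j=0}^{n} (−1)ʲ η(A₀, …, AⱼA_{j+1}, …, A_{n+1}) + (−1)^{n+1} η(A_{n+1}A₀, A₁, …, Aₙ) = 0. -/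
open scoped BigOperators

theorem hoch_telescope {B : Type*} [Ring B] [Algebra ℂ B] (n : ℕ) :
    ∀ (E : Fin n → (B →ₗ[ℂ] B))
    (_ : ∀ j : Fin n, ∀ a b : B, E j (a * b) = E j a * b + a * E j b)
    (A : Fin (n + 2) → B) (c : Fin (n + 1) → Fin (n + 1) → B)
    (_ : ∀ j i, c j i = if (i : ℕ) < (j : ℕ) then A i.castSucc
            else if i = j then A j.castSucc * A j.succ
            else A i.succ),
    ∑ j : Fin (n + 1), (-1 : ℂ) ^ (j : ℕ) •
      (c j 0 * (List.ofFn fun i : Fin n => E i (c j i.succ)).prod) =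
    (-1 : ℂ) ^ n • (A 0 * (List.ofFn fun i : Fin n => E i (A i.succ.castSucc)).prod
      * A (Fin.last (n + 1))) := by
  induction n with
  | zero =>
    intro E hE A c hc
    simp [hc]
  | succ n ih =>
    intro E hE A c hc
    have key := ih (fun i => E i.castSucc) (fun j => hE j.castSucc) (fun i => A i.castSucc)
      (fun j i => c j.castSucc i.castSucc) (by
        intro j i
        rw [hc]
        simp)
    have h1 : ∀ j : Fin (n + 1), c j.castSucc (Fin.last (n + 1)) = A (Fin.last (n + 2)) := by
      intro j
      rw [hc, if_neg (by have := j.2; simp),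
        if_neg (by intro h; have := j.2; have := congrArg Fin.val h; simp at this; omega)]
      simp
    have h2 : c (Fin.last (n + 1)) (Fin.last (n + 1))
        = A (Fin.last (n + 1)).castSucc * A (Fin.last (n + 2)) := by
      rw [hc]; simp
    have h3 : ∀ i : Fin (n + 1), c (Fin.last (n + 1)) i.castSucc = A i.castSucc.castSucc := by
      intro i
      rw [hc, if_pos (by have := i.2; simp; omega)]
    have p : ∀ f : Fin (n + 1) → B, (List.ofFn f).prod
        = (List.ofFn fun i : Fin n => f i.castSucc).prod * f (Fin.last n) := by
      intro f
      rw [List.ofFn_succ']; simp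
    rw [Fin.sum_univ_castSucc]
    simp only [p, Fin.succ_last, Fin.succ_castSucc, h1, h2, h3, hE, Fin.val_castSucc, Fin.val_last]
    have h30 : c (Fin.last (n + 1)) 0 = A 0 := h3 0
    rw [h30]
    have key2 := congrArg (fun x => x * E (Fin.last n) (A (Fin.last (n + 2)))) key
    simp only [Finset.sum_mul, smul_mul_assoc, Fin.castSucc_zero] at key2
    simp only [← mul_assoc, mul_add, smul_add] at key2 ⊢
    rw [key2, pow_succ]
    simp only [mul_neg, mul_one, neg_smul]
    abel


/-- The Hochschild coboundary of the character
`η(A₀,…,Aₙ) = Σ_σ sgn(σ) T(A₀ ∇_{σ(1)}A₁ ⋯ ∇_{σ(n)}Aₙ)` built from an invariant trace `T`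
and `n` commuting derivations vanishes (Proposition 4.5). -/
theorem character_of_invariant_trace_is_hochschild_cocycle
    (n : ℕ) (B : Type*) [Ring B] [Algebra ℂ B]
    (T : B →ₗ[ℂ] ℂ) (hT : ∀ a b : B, T (a * b) = T (b * a))
    (D : Fin n → (B →ₗ[ℂ] B))
    (hder : ∀ j : Fin n, ∀ a b : B, D j (a * b) = D j a * b + a * D j b)
    (hcomm : ∀ i j : Fin n, ∀ a : B, D i (D j a) = D j (D i a))
    (hinv : ∀ j : Fin n, ∀ a : B, T (D j a) = 0)
    (η : (Fin (n + 1) → B) → ℂ)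
    (hη : ∀ A : Fin (n + 1) → B,
      η A = ∑ σ : Equiv.Perm (Fin n),
        ((Equiv.Perm.sign σ : ℤ) : ℂ) *
          T (A 0 * (List.ofFn fun j : Fin n => D (σ j) (A j.succ)).prod)) :
    ∀ A : Fin (n + 2) → B,
      (∑ j : Fin (n + 1), (-1 : ℂ) ^ (j : ℕ) *
          η (fun i : Fin (n + 1) =>
            if (i : ℕ) < (j : ℕ) then A i.castSucc
            else if i = j then A j.castSucc * A j.succ
            else A i.succ))
        + (-1 : ℂ) ^ (n + 1) *
            η (fun i : Fin (n + 1) =>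
              if i = 0 then A (Fin.last (n + 1)) * A 0 else A i.castSucc) = 0 := by
  intro A
  simp only [hη, Finset.mul_sum]
  rw [Finset.sum_comm, ← Finset.sum_add_distrib]
  refine Finset.sum_eq_zero fun σ _ => ?_
  have key := congrArg T (hoch_telescope n (fun i => D (σ i)) (fun j => hder (σ j)) A _
    (fun j i => rfl))
  rw [map_sum] at key
  simp only [map_smul, smul_eq_mul] at key
  have e : ∀ (a s t : ℂ), a * (s * t) = s * (a * t) := fun a s t => by ring
  simp only [e _ ((Equiv.Perm.sign σ : ℤ) : ℂ)]
  rw [← Finset.mul_sum, ← mul_add, key, hT _ (A (Fin.last (n + 1)))]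
  simp only [if_true, Fin.succ_ne_zero, if_false, pow_succ, mul_assoc]
  ring
end

section
/- Let B be a complex Banach algebra and α : ℝ → Aut(B) a group homomorphism into the algebra automorphisms of B such that each α_t is isometric and the map (t, b) ↦ α_t(b) is continuous. For continuous compactly supported functions f, g : ℝ → (ℝ → B) (written f(x)(s), jointly continuous with compact support), define two twisted convolution products: (f ⋆_α g)(x)(s) = ∫_ℝ f(y)(s) · α_y(g(x − y)(s − y)) dy and (f ⋆₀ g)(x)(s) = ∫_ℝ f(y)(s) · g(x − y)(s − y) dy. Define Ψ(f)(x)(s) = α_{−s}(f(x)(s)). Then Ψ intertwines the two products: Ψ(f ⋆_α g) = Ψ(f) ⋆₀ Ψ(g) for all such f, g. -/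
open MeasureTheory

/-- Rieffel's map `Ψ(f)(x)(s) = α_{−s}(f(x)(s))` intertwines the twisted convolution
`⋆_α` with the untwisted one `⋆₀` (formula (A.1) of the appendix of the paper). -/
theorem rieffel_map_intertwines
    (B : Type*) [NormedRing B] [NormedAlgebra ℂ B] [CompleteSpace B]
    (α : ℝ → B ≃ₐ[ℂ] B)
    (hα_zero : ∀ b : B, α 0 b = b)
    (hα_add : ∀ s t : ℝ, ∀ b : B, α (s + t) b = α s (α t b))
    (hα_iso : ∀ t : ℝ, ∀ b : B, ‖α t b‖ = ‖b‖)
    (hα_cont : Continuous fun p : ℝ × B => α p.1 p.2)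
    (f g : ℝ → ℝ → B)
    (hf : Continuous (Function.uncurry f)) (hfs : HasCompactSupport (Function.uncurry f))
    (hg : Continuous (Function.uncurry g)) (hgs : HasCompactSupport (Function.uncurry g)) :
    ∀ x s : ℝ,
      α (-s) (∫ y : ℝ, f y s * α y (g (x - y) (s - y))) =
        ∫ y : ℝ, α (-s) (f y s) * α (-(s - y)) (g (x - y) (s - y)) := by
  intro x s
  let L : B ≃ₗᵢ[ℂ] B := { (α (-s)).toLinearEquiv with norm_map' := fun b => hα_iso (-s) b }
  have h := L.toContinuousLinearEquiv.integral_comp_comm (μ := volume)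
    (fun y : ℝ => f y s * α y (g (x - y) (s - y)))
  refine Eq.trans h.symm (integral_congr_ae (Filter.Eventually.of_forall fun y => ?_))
  change α (-s) (f y s * α y (g (x - y) (s - y))) =
    α (-s) (f y s) * α (-(s - y)) (g (x - y) (s - y))
  rw [map_mul, ← hα_add, show -s + y = -(s - y) by ring]
end
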